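/- arXiv:1907.07022 — 2 statements merged into one kernel-verified Lean document; each statement's English description precedes it below -/
import Mathlib

section
/- Let T_1, ..., T_n (n ≥ 3) be pairwise disjoint subtrees of a tree, all at equal pairwise distance λ > 0, and let v_i ∈ T_i be the point of T_i nearest to T_j for some j ≠ i. Then v_i is independent of the choice of j; that is, the nearest point of T_i to T_j equals the nearest point of T_i to T_k for all j, k ≠ i. -/
/-- `w` lies on the geodesic between `u` and `v` (w.r.t. the edge-path metric). -/
def OnGeod {V : Type*} (T : SimpleGraph V) (u w v : V) : Prop :=
  T.dist u w + T.dist w v = T.dist u v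

/-- A subtree of a simplicial tree: a nonempty, geodesically convex set of vertices. -/
def IsSubtree {V : Type*} (T : SimpleGraph V) (S : Set V) : Prop :=
  S.Nonempty ∧ ∀ u ∈ S, ∀ v ∈ S, ∀ w : V, OnGeod T u w v → w ∈ S

/-- The distance between two sets of vertices. -/
noncomputable def setDist {V : Type*} (T : SimpleGraph V) (A B : Set V) : ℕ :=
  sInf {n : ℕ | ∃ a ∈ A, ∃ b ∈ B, T.dist a b = n}

/-- `v` is a nearest point of `A` to `B`. -/
def IsNearestPt {V : Type*} (T : SimpleGraph V) (v : V) (A B : Set V) : Prop :=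
  v ∈ A ∧ ∃ b ∈ B, T.dist v b = setDist T A B

namespace SimpleGraph

variable {V : Type*} {T : SimpleGraph V}

theorem IsTree.length_eq_dist_of_isPath (hT : T.IsTree) {u v : V} {p : T.Walk u v}
    (hp : p.IsPath) : p.length = T.dist u v := by
  obtain ⟨q, hq, hql⟩ := hT.connected.exists_path_of_dist u v
  rw [← hql, (hT.existsUnique_path u v).unique hp hq]

/-- In a tree, two geodesics overlapping in a nontrivial segment concatenate to a geodesic. -/
theorem IsTree.dist_eq_of_onGeod_of_onGeod (hT : T.IsTree) {x v w y : V} (hvw : v ≠ w)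
    (hx : OnGeod T x v w) (hy : OnGeod T v w y) :
    T.dist x y = T.dist x v + T.dist v w + T.dist w y := by
  obtain ⟨p, hp⟩ := hT.connected.exists_walk_length_eq_dist x v
  obtain ⟨q, hq⟩ := hT.connected.exists_walk_length_eq_dist v w
  obtain ⟨r, hr⟩ := hT.connected.exists_walk_length_eq_dist w y
  unfold OnGeod at hx hy
  have hpq : (p.append q).IsPath :=
    Walk.isPath_of_length_eq_dist _ (by rw [Walk.length_append]; omega)
  have hqr : (q.append r).IsPath :=
    Walk.isPath_of_length_eq_dist _ (by rw [Walk.length_append]; omega)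
  rw [hT.isAcyclic.isPath_iff_isChain, Walk.edges_append] at hpq hqr
  have hq0 : q.edges ≠ [] := by
    intro h
    have hlen := q.length_edges
    rw [h, hq, List.length_nil, eq_comm, hT.connected.dist_eq_zero_iff] at hlen
    exact hvw hlen
  have hpath : ((p.append q).append r).IsPath := by
    rw [hT.isAcyclic.isPath_iff_isChain, Walk.edges_append, Walk.edges_append]
    exact hpq.append_overlap hqr hq0
  rw [← hT.length_eq_dist_of_isPath hpath, Walk.length_append, Walk.length_append, hp, hq, hr]

theorem Connected.exists_adj_onGeod (hT : T.Connected) {v a : V} (hva : v ≠ a) :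
    ∃ u, T.Adj v u ∧ OnGeod T v u a := by
  obtain ⟨p, hp⟩ := hT.exists_walk_length_eq_dist v a
  cases p with
  | nil => exact absurd rfl hva
  | @cons _ u _ h q =>
    refine ⟨u, h, ?_⟩
    have hvu := dist_eq_one_iff_adj.mpr h
    have hle := dist_le q
    have htri := hT.dist_triangle (u := v) (v := u) (w := a)
    rw [Walk.length_cons] at hp
    unfold OnGeod
    omega

end SimpleGraph

section Subtree

variable {V : Type*} {T : SimpleGraph V}

theorem OnGeod.symm {u w v : V} (h : OnGeod T u w v) : OnGeod T v w u := by
  unfold OnGeod at *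
  rw [T.dist_comm (u := v) (v := w), T.dist_comm (u := w) (v := u),
    T.dist_comm (u := v) (v := u), ← h, add_comm]

/-- A point of a subtree nearest to `b` lies on every geodesic from the subtree to `b`. -/
theorem IsSubtree.onGeod_of_forall_dist_le (hT : T.IsTree) {A : Set V} (hA : IsSubtree T A)
    {v b : V} (hv : v ∈ A) (hmin : ∀ a ∈ A, T.dist v b ≤ T.dist a b) {a : V} (ha : a ∈ A) :
    OnGeod T a v b := by
  obtain rfl | hva := eq_or_ne v a
  · simp [OnGeod]
  obtain ⟨u, hadj, hu⟩ := hT.connected.exists_adj_onGeod hva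
  have huA := hmin u (hA.2 v hv a ha u hu)
  have huv : OnGeod T u v b := by
    have h1 := SimpleGraph.dist_eq_one_iff_adj.mpr hadj.symm
    have h2 := hT.dist_eq_dist_add_one_of_adj b hadj
    rw [T.dist_comm (u := b) (v := u), T.dist_comm (u := b) (v := v)] at h2
    unfold OnGeod
    omega
  have h := hT.dist_eq_of_onGeod_of_onGeod hadj.ne.symm hu.symm huv
  have h' := hu.symm
  unfold OnGeod at *
  omega

theorem setDist_le_dist {A B : Set V} {a b : V} (ha : a ∈ A) (hb : b ∈ B) :
    setDist T A B ≤ T.dist a b :=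
  Nat.sInf_le ⟨a, ha, b, hb, rfl⟩

theorem exists_dist_eq_setDist {A B : Set V} (hA : A.Nonempty) (hB : B.Nonempty) :
    ∃ a ∈ A, ∃ b ∈ B, T.dist a b = setDist T A B :=
  Nat.sInf_mem (s := {n : ℕ | ∃ a ∈ A, ∃ b ∈ B, T.dist a b = n})
    (hA.elim fun a ha => hB.elim fun b hb => ⟨_, a, ha, b, hb, rfl⟩)

/-- The nearest point of a subtree `A` to a subtree `B` at positive distance is the projection
to `A` of every point of `B`. -/
theorem IsNearestPt.onGeod (hT : T.IsTree) {A B : Set V} (hA : IsSubtree T A)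
    (hB : IsSubtree T B) (hpos : 0 < setDist T A B) {v a b : V} (hv : IsNearestPt T v A B)
    (ha : a ∈ A) (hb : b ∈ B) : OnGeod T a v b := by
  obtain ⟨hvA, c, hc, hvc⟩ := hv
  have h1 : OnGeod T a v c := hA.onGeod_of_forall_dist_le hT hvA
    (fun x hx => hvc ▸ setDist_le_dist hx hc) ha
  have h2 : OnGeod T b c v := hB.onGeod_of_forall_dist_le hT hc
    (fun x hx => by
      rw [T.dist_comm (u := c), T.dist_comm (u := x), hvc]
      exact setDist_le_dist hvA hx) hb
  have hne : v ≠ c := by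
    rintro rfl
    rw [SimpleGraph.dist_self] at hvc
    omega
  have h := hT.dist_eq_of_onGeod_of_onGeod hne h1 h2.symm
  have h3 := h2.symm
  unfold OnGeod at *
  omega

end Subtree

/-- Given `n ≥ 3` pairwise disjoint subtrees all at equal pairwise distance `λ > 0`, the
nearest point of `X i` to `X j` does not depend on the choice of `j ≠ i`. -/
theorem stmt_12 {V : Type*} (T : SimpleGraph V) (hT : T.IsTree)
    {n : ℕ} (hn : 3 ≤ n) (X : Fin n → Set V)
    (hsub : ∀ i, IsSubtree T (X i))
    (hdisj : ∀ i j, i ≠ j → X i ∩ X j = ∅)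
    (lam : ℕ) (hlam : 0 < lam)
    (hdist : ∀ i j, i ≠ j → setDist T (X i) (X j) = lam)
    (i j k : Fin n) (hj : j ≠ i) (hk : k ≠ i)
    (v v' : V)
    (hv : IsNearestPt T v (X i) (X j))
    (hv' : IsNearestPt T v' (X i) (X k)) :
    v = v' := by
  have hposj : 0 < setDist T (X i) (X j) := by rwa [hdist i j hj.symm]
  have hposk : 0 < setDist T (X i) (X k) := by rwa [hdist i k hk.symm]
  by_contra hne
  have key : ∀ b ∈ X j, ∀ c ∈ X k, 2 * lam < T.dist b c := by
    intro b hb c hc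
    have h1 : OnGeod T v' v b := hv.onGeod hT (hsub i) (hsub j) hposj hv'.1 hb
    have h2 : OnGeod T v v' c := hv'.onGeod hT (hsub i) (hsub k) hposk hv.1 hc
    have h := hT.dist_eq_of_onGeod_of_onGeod hne h1.symm h2
    have hb' : setDist T (X i) (X j) ≤ T.dist v b := setDist_le_dist hv.1 hb
    have hc' : setDist T (X i) (X k) ≤ T.dist v' c := setDist_le_dist hv'.1 hc
    rw [hdist i j hj.symm, T.dist_comm] at hb'
    rw [hdist i k hk.symm] at hc'
    have := hT.connected.pos_dist_of_ne hne
    omega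
  obtain rfl | hjk := eq_or_ne j k
  · obtain ⟨b, hb⟩ := (hsub j).1
    have := key b hb b hb
    rw [SimpleGraph.dist_self] at this
    omega
  · obtain ⟨b, hb, c, hc, hbc⟩ := exists_dist_eq_setDist (T := T) (hsub j).1 (hsub k).1
    have := key b hb c hc
    rw [hbc, hdist j k hjk] at this
    omega
end

section
/- Let G be a countable group. Then G has Property (FA) if and only if: G is not a non-trivial amalgamated free product, G has no quotient isomorphic to ℤ, and G is finitely generated. In particular, a countable group with Property (FA) is finitely generated. -/
/-- Property (FA): every action by graph automorphisms, without inversions, on a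
simplicial tree has a global fixed point. -/
def HasFA (G : Type*) [Group G] : Prop :=
  ∀ (V : Type) (T : SimpleGraph V), T.IsTree →
    ∀ ρ : G →* Equiv.Perm V,
      (∀ (g : G) (u v : V), T.Adj u v → T.Adj (ρ g u) (ρ g v)) →
      (∀ (g : G) (u v : V), T.Adj u v → ¬(ρ g u = v ∧ ρ g v = u)) →
      ∃ x : V, ∀ g : G, ρ g x = x

universe u

/-- The two-element family of groups `A, B`, indexed by `Bool`. -/
def FactorFam (A B : Type u) : Bool → Type u := fun b => bif b then A else B

instance {A B : Type u} [Group A] [Group B] : ∀ b, Group (FactorFam A B b)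
  | true => ‹Group A›
  | false => ‹Group B›

/-- The pair of maps `i : C →* A`, `j : C →* B`, as a family over `Bool`. -/
def phiFam {A B C : Type u} [Group A] [Group B] [Group C] (i : C →* A) (j : C →* B) :
    ∀ b : Bool, C →* FactorFam A B b
  | true => i
  | false => j

/-- A witness that `G` is a non-trivial amalgamated free product `A *_C B`:
`C` embeds as a proper subgroup of both `A` and `B`, and `G` is isomorphic to the
amalgamated free product (pushout) of `A` and `B` over `C`. -/
structure AmalgamWitness (G : Type*) [Group G] where
  A : Type
  B : Type
  C : Type
  [gA : Group A]
  [gB : Group B]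
  [gC : Group C]
  i : C →* A
  j : C →* B
  inj_i : Function.Injective i
  inj_j : Function.Injective j
  not_surj_i : ¬ Function.Surjective i
  not_surj_j : ¬ Function.Surjective j
  iso : G ≃* Monoid.PushoutI (phiFam i j)

namespace SimpleGraph

variable {V : Type*} {T : SimpleGraph V}

/-- The set of vertices lying on the side of `b` once the edge `s(a, b)` is removed. -/
def halfSpace (T : SimpleGraph V) (a b : V) : Set V :=
  {z | (T.deleteEdges {s(a, b)}).Reachable b z}

theorem mem_halfSpace_self (a b : V) : b ∈ T.halfSpace a b := Reachable.refl _

/-- The only edge entering a half-space is its defining edge. -/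
theorem eq_of_adj_of_mem_halfSpace {a b x y : V} (h : T.Adj x y) (hx : x ∉ T.halfSpace a b)
    (hy : y ∈ T.halfSpace a b) : x = a ∧ y = b := by
  by_cases he : s(x, y) = s(a, b)
  · rcases Sym2.eq_iff.1 he with h' | ⟨rfl, rfl⟩
    · exact h'
    · exact absurd (mem_halfSpace_self _ _) hx
  · refine absurd ?_ hx
    have hadj : (T.deleteEdges {s(a, b)}).Adj y x := by
      rw [deleteEdges_adj]
      exact ⟨h.symm, fun h' => he (Sym2.eq_swap.trans h')⟩
    exact Reachable.trans hy hadj.reachable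

theorem IsTree.notMem_halfSpace (hT : T.IsTree) {a b : V} (h : T.Adj a b) :
    a ∉ T.halfSpace a b := by
  intro ha
  exact isBridge_iff.1 (isAcyclic_iff_forall_adj_isBridge.1 hT.isAcyclic h) ha.symm

theorem halfSpace_induction {a b : V} {P : V → Prop} (hb : P b)
    (hstep : ∀ x y, x ∈ T.halfSpace a b → y ∈ T.halfSpace a b → T.Adj x y → P x → P y) :
    ∀ z ∈ T.halfSpace a b, P z := by
  intro z hz
  have hz' := (reachable_iff_reflTransGen _ _).1 hz
  induction hz' with
  | refl => exact hb
  | tail h1 h2 ih =>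
    have hm := (reachable_iff_reflTransGen _ _).2 h1
    exact hstep _ _ hm hz (deleteEdges_le _ h2) (ih hm)

/-- Nesting criterion for half-spaces. -/
theorem halfSpace_subset {a b c d : V} (ha : a ∉ T.halfSpace c d) (hd : d ∈ T.halfSpace a b) :
    T.halfSpace c d ⊆ T.halfSpace a b := by
  refine halfSpace_induction hd fun x y _ hy hxy hx => ?_
  by_contra hy'
  obtain ⟨rfl, -⟩ := eq_of_adj_of_mem_halfSpace hxy.symm hy' hx
  exact ha hy

theorem IsTree.mem_halfSpace_swap (hT : T.IsTree) {a b : V} (h : T.Adj a b) (z : V) :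
    z ∈ T.halfSpace b a ↔ z ∉ T.halfSpace a b := by
  constructor
  · intro hz hz'
    have : (T.deleteEdges {s(a, b)}).Reachable a z := by
      have hz : (T.deleteEdges {s(b, a)}).Reachable a z := hz
      rwa [Sym2.eq_swap] at hz
    exact hT.notMem_halfSpace h (hz'.trans this.symm)
  · have hz := (reachable_iff_reflTransGen _ _).1 (hT.connected a z)
    induction hz with
    | refl => exact fun _ => mem_halfSpace_self _ _
    | @tail x y _ hxy ih =>
      intro hy
      by_cases hx : x ∈ T.halfSpace a b
      · obtain ⟨rfl, -⟩ := eq_of_adj_of_mem_halfSpace hxy.symm hy hx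
        exact mem_halfSpace_self _ _
      · by_contra hy'
        obtain ⟨rfl, rfl⟩ := eq_of_adj_of_mem_halfSpace hxy.symm hy' (ih hx)
        exact hy (mem_halfSpace_self _ _)

theorem Connected.dist_lt_of_mem_halfSpace (hT : T.Connected) {a b : V}
    (ha : a ∉ T.halfSpace a b) {z : V} (hz : z ∈ T.halfSpace a b) :
    T.dist z b < T.dist z a := by
  obtain ⟨p, hp⟩ := hT.exists_walk_length_eq_dist z a
  rw [← hp]
  clear hp
  induction p with
  | nil => exact absurd hz ha
  | @cons x y a h p ih =>
    by_cases hy : y ∈ T.halfSpace a b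
    · have := ih ha hy
      have h2 := hT.dist_triangle (u := x) (v := y) (w := b)
      rw [dist_eq_one_iff_adj.2 h] at h2
      rw [Walk.length_cons]
      omega
    · obtain ⟨-, rfl⟩ := eq_of_adj_of_mem_halfSpace h.symm hy hz
      simp

theorem IsTree.mem_halfSpace_iff (hT : T.IsTree) {a b : V} (h : T.Adj a b) (z : V) :
    z ∈ T.halfSpace a b ↔ T.dist z b < T.dist z a := by
  refine ⟨hT.connected.dist_lt_of_mem_halfSpace (hT.notMem_halfSpace h), fun hlt => ?_⟩
  by_contra hz
  have := hT.connected.dist_lt_of_mem_halfSpace (hT.notMem_halfSpace h.symm)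
    ((hT.mem_halfSpace_swap h z).2 hz)
  omega

theorem Connected.exists_adj_dist_lt (hT : T.Connected) {x y : V} (hxy : x ≠ y) :
    ∃ z, T.Adj x z ∧ T.dist y z < T.dist y x := by
  obtain ⟨p, hp⟩ := hT.exists_walk_length_eq_dist x y
  cases p with
  | nil => exact absurd rfl hxy
  | @cons _ z _ h p =>
    refine ⟨z, h, ?_⟩
    rw [dist_comm, dist_comm (u := y), ← hp, Walk.length_cons]
    exact Nat.lt_succ_of_le (dist_le p)

section Action

variable {G : Type*} [Group G] [MulAction G V]

theorem smul_mem_halfSpace_of_mem (hadj : ∀ (g : G) (u v : V), T.Adj u v → T.Adj (g • u) (g • v))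
    (g : G) {a b z : V} (hz : z ∈ T.halfSpace a b) :
    g • z ∈ T.halfSpace (g • a) (g • b) := by
  have hz' := (reachable_iff_reflTransGen _ _).1 hz
  refine (reachable_iff_reflTransGen _ _).2 (hz'.lift (g • ·) fun x y h => ?_)
  rw [deleteEdges_adj] at h
  rw [Function.onFun, deleteEdges_adj]
  refine ⟨hadj g _ _ h.1, fun h' => h.2 ?_⟩
  simpa using h'

theorem smul_mem_halfSpace_iff (hadj : ∀ (g : G) (u v : V), T.Adj u v → T.Adj (g • u) (g • v))
    (g : G) {a b z : V} : g • z ∈ T.halfSpace (g • a) (g • b) ↔ z ∈ T.halfSpace a b :=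
  ⟨fun h => by simpa using smul_mem_halfSpace_of_mem hadj g⁻¹ h, smul_mem_halfSpace_of_mem hadj g⟩

theorem mem_halfSpace_smul_iff (hadj : ∀ (g : G) (u v : V), T.Adj u v → T.Adj (g • u) (g • v))
    (g : G) {a b z : V} : z ∈ T.halfSpace (g • a) (g • b) ↔ g⁻¹ • z ∈ T.halfSpace a b := by
  rw [← smul_mem_halfSpace_iff hadj g (z := g⁻¹ • z), smul_inv_smul]

/-- An element which translates no half-space strictly into itself fixes a vertex. -/
theorem IsTree.exists_smul_eq (hT : T.IsTree)
    (hadj : ∀ (g : G) (u v : V), T.Adj u v → T.Adj (g • u) (g • v))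
    (hinv : ∀ (g : G) (u v : V), T.Adj u v → ¬(g • u = v ∧ g • v = u))
    (hno : ∀ (g : G) (u v : V), T.Adj u v →
      ¬ T.halfSpace (g • u) (g • v) ⊂ T.halfSpace u v) (s : G) :
    ∃ x : V, s • x = x := by
  suffices H : ∀ (n : ℕ) (x : V), T.dist x (s • x) = n → ∃ x : V, s • x = x by
    obtain ⟨x⟩ := hT.connected.nonempty
    exact H _ x rfl
  intro n
  induction n using Nat.strong_induction_on with
  | _ n ih =>
    intro x hx
    by_cases hsx : s • x = x
    · exact ⟨x, hsx⟩
    obtain ⟨y, hxy, hd⟩ := hT.connected.exists_adj_dist_lt (Ne.symm hsx)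
    by_cases hlt : T.dist y (s • y) < n
    · exact ih _ hlt y rfl
    exfalso
    have hsxm : s • x ∈ T.halfSpace x y := (hT.mem_halfSpace_iff hxy _).2 hd
    have hsym : s • y ∈ T.halfSpace x y := by
      by_contra hcon
      obtain ⟨h1, h2⟩ := eq_of_adj_of_mem_halfSpace (hadj s _ _ hxy.symm) hcon hsxm
      exact hinv s x y hxy ⟨h2, h1⟩
    have hd' := (hT.mem_halfSpace_iff hxy _).1 hsym
    have hxm : x ∉ T.halfSpace (s • x) (s • y) := by
      rw [hT.mem_halfSpace_iff (hadj s _ _ hxy)]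
      rw [dist_comm (u := s • y), dist_comm (u := s • y)] at hd'
      omega
    refine hno s x y hxy ⟨halfSpace_subset hxm hsym, fun h => ?_⟩
    exact hT.notMem_halfSpace (hadj s _ _ hxy) (h hsxm)

/-- If a set `S` of elements and an element `s` both have fixed vertices but no common one, then
some product translates a half-space strictly into itself. -/
theorem IsTree.exists_common_fixed (hT : T.IsTree)
    (hadj : ∀ (g : G) (u v : V), T.Adj u v → T.Adj (g • u) (g • v))
    (hno : ∀ (g : G) (u v : V), T.Adj u v →
      ¬ T.halfSpace (g • u) (g • v) ⊂ T.halfSpace u v) (S : Set G) (s : G)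
    {x y : V} (hx : ∀ t ∈ S, t • x = x) (hy : s • y = y) :
    ∃ z : V, s • z = z ∧ ∀ t ∈ S, t • z = z := by
  -- moving the end of an edge which it does not fix, an elliptic element displaces the half-space
  have hdisj : ∀ (t : G) (a b : V), T.Adj a b → t • a = a → t • b ≠ b →
      T.halfSpace a (t • b) ⊆ T.halfSpace b a := by
    intro t a b hab hta htb
    have hab' : T.Adj a (t • b) := by simpa [hta] using hadj t _ _ hab
    have h0 : T.dist b (t • b) ≠ 0 := fun h => htb (hT.connected.dist_eq_zero_iff.1 h).symm
    have h1 : b ∉ T.halfSpace a (t • b) := by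
      rw [hT.mem_halfSpace_iff hab', dist_eq_one_iff_adj.2 hab.symm]
      omega
    refine halfSpace_subset h1 ?_
    rw [hT.mem_halfSpace_swap hab]
    intro h2
    obtain ⟨-, h3⟩ := eq_of_adj_of_mem_halfSpace hab' (hT.notMem_halfSpace hab) h2
    exact htb h3
  induction hn : T.dist x y using Nat.strong_induction_on generalizing x y with
  | _ n ih =>
    by_cases hxy : x = y
    · exact ⟨x, hxy ▸ hy, hx⟩
    obtain ⟨x₁, hxx, hdx⟩ := hT.connected.exists_adj_dist_lt hxy
    obtain ⟨y₁, hyy, hdy⟩ := hT.connected.exists_adj_dist_lt (Ne.symm hxy)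
    by_cases hx₁ : ∀ t ∈ S, t • x₁ = x₁
    · exact ih _ (by rw [dist_comm, ← hn, dist_comm (u := x)]; exact hdx) hx₁ hy rfl
    by_cases hy₁ : s • y₁ = y₁
    · exact ih _ (by rw [← hn]; exact hdy) hx hy₁ rfl
    exfalso
    push Not at hx₁
    obtain ⟨t, htS, ht⟩ := hx₁
    have hA : T.halfSpace y₁ y ⊆ T.halfSpace x x₁ := by
      refine halfSpace_subset ?_ ((hT.mem_halfSpace_iff hxx _).2 hdx)
      rw [hT.mem_halfSpace_iff hyy.symm]
      omega
    have hB : T.halfSpace x₁ x ⊆ T.halfSpace y y₁ := by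
      intro z hz
      rw [hT.mem_halfSpace_swap hxx] at hz
      rw [hT.mem_halfSpace_swap hyy.symm]
      exact fun h => hz (hA h)
    have h1 := hdisj t x x₁ hxx (hx t htS) ht
    have h2 := hdisj s y y₁ hyy hy hy₁
    refine hno (s * t) x x₁ hxx ⟨?_, fun hsub => ?_⟩
    · intro z hz
      rw [mul_smul, mul_smul, mem_halfSpace_smul_iff hadj, hx t htS] at hz
      have h3 := smul_mem_halfSpace_of_mem hadj s (hB (h1 hz))
      rw [smul_inv_smul, hy] at h3
      exact hA (h2 h3)
    · have h3 : s • x ∈ T.halfSpace x x₁ := by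
        have h4 : x ∈ T.halfSpace y y₁ := hB (mem_halfSpace_self _ _)
        have h5 := smul_mem_halfSpace_of_mem hadj s h4
        rw [hy] at h5
        exact hA (h2 h5)
      have h4 := hsub h3
      rw [mul_smul, mul_smul, smul_mem_halfSpace_iff hadj, hx t htS] at h4
      refine hT.notMem_halfSpace ?_ h4
      simpa [hx t htS] using hadj t _ _ hxx

/-- A finitely generated group acting on a tree without a global fixed vertex contains an element
translating a half-space strictly into itself. -/
theorem IsTree.exists_fixed_of_fg [Group.FG G] (hT : T.IsTree)
    (hadj : ∀ (g : G) (u v : V), T.Adj u v → T.Adj (g • u) (g • v))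
    (hinv : ∀ (g : G) (u v : V), T.Adj u v → ¬(g • u = v ∧ g • v = u))
    (hno : ∀ (g : G) (u v : V), T.Adj u v →
      ¬ T.halfSpace (g • u) (g • v) ⊂ T.halfSpace u v) :
    ∃ x : V, ∀ g : G, g • x = x := by
  classical
  obtain ⟨S, hS⟩ := (Group.fg_def.1 ‹Group.FG G›)
  have key : ∃ x : V, ∀ s ∈ (S : Set G), s • x = x := by
    clear hS
    induction S using Finset.induction_on with
    | empty =>
      obtain ⟨x⟩ := hT.connected.nonempty
      exact ⟨x, by simp⟩
    | insert s S _ ih =>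
      obtain ⟨x, hx⟩ := ih
      obtain ⟨y, hy⟩ := hT.exists_smul_eq hadj hinv hno s
      obtain ⟨z, hz, hz'⟩ := hT.exists_common_fixed hadj hno S s hx hy
      refine ⟨z, fun t ht => ?_⟩
      rw [Finset.coe_insert] at ht
      rcases ht with rfl | ht
      exacts [hz, hz' t ht]
  obtain ⟨x, hx⟩ := key
  refine ⟨x, fun g => ?_⟩
  have : Subgroup.closure (S : Set G) ≤ MulAction.stabilizer G x :=
    (Subgroup.closure_le _).2 hx
  rw [hS] at this
  exact this (Subgroup.mem_top g)

end Action

end SimpleGraph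

theorem exists_surjective_hom_int {G : Type*} [Group G] (c : G → ℤ)
    (hc : ∀ g h, c (g * h) = c g + c h) (hne : ∃ g, c g ≠ 0) :
    ∃ f : G →* Multiplicative ℤ, Function.Surjective f := by
  let φ : G →* Multiplicative ℤ := MonoidHom.mk' (fun g => Multiplicative.ofAdd (c g))
    fun g h => by rw [hc, ofAdd_add]
  let R : AddSubgroup ℤ := (Subgroup.toAddSubgroup φ.range)
  have hR : ∀ n, n ∈ R ↔ ∃ g, c g = n := fun n => Iff.rfl
  obtain ⟨a, ha⟩ := Int.subgroup_cyclic R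
  rw [← AddSubgroup.zmultiples_eq_closure] at ha
  have hdvd : ∀ g, a ∣ c g := fun g => by
    have : c g ∈ R := (hR _).2 ⟨g, rfl⟩
    rwa [ha, Int.mem_zmultiples_iff] at this
  have ha0 : a ≠ 0 := by
    rintro rfl
    obtain ⟨g, hg⟩ := hne
    exact hg (zero_dvd_iff.1 (hdvd g))
  obtain ⟨g₀, hg₀⟩ : ∃ g, c g = a := (hR a).1 (ha ▸ AddSubgroup.mem_zmultiples a)
  let ψ : G →* Multiplicative ℤ := MonoidHom.mk' (fun g => Multiplicative.ofAdd (c g / a))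
    fun g h => by rw [hc, Int.add_ediv_of_dvd_left (hdvd g), ofAdd_add]
  refine ⟨ψ, fun n => ⟨g₀ ^ (Multiplicative.toAdd n), ?_⟩⟩
  have h1 : ψ g₀ = Multiplicative.ofAdd 1 := by
    change Multiplicative.ofAdd (c g₀ / a) = _
    rw [hg₀, Int.ediv_self ha0]
  rw [map_zpow, h1, ← ofAdd_zsmul]
  simp

namespace SimpleGraph

variable {V : Type*} {T : SimpleGraph V} {G : Type*} [Group G] [MulAction G V]

/-- The change, from `x` to `y`, of the membership in the half-space of the oriented edge `p`. -/
noncomputable def halfSpaceDiff (T : SimpleGraph V) (x y : V) (p : V × V) : ℤ :=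
  (T.halfSpace p.1 p.2).indicator 1 y - (T.halfSpace p.1 p.2).indicator 1 x

/-- The signed number of edges in the orbit of the oriented edge `(u, v)` which are crossed
between `x` and `y`. -/
noncomputable def signedCrossing (G : Type*) [Group G] [MulAction G V] (T : SimpleGraph V)
    (u v x y : V) : ℤ :=
  ∑ᶠ p : MulAction.orbit G (u, v), T.halfSpaceDiff x y p

theorem halfSpaceDiff_eq_zero_iff {x y : V} {p : V × V} :
    T.halfSpaceDiff x y p = 0 ↔ (x ∈ T.halfSpace p.1 p.2 ↔ y ∈ T.halfSpace p.1 p.2) := by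
  classical
  by_cases hx : x ∈ T.halfSpace p.1 p.2 <;> by_cases hy : y ∈ T.halfSpace p.1 p.2 <;>
    simp [halfSpaceDiff, hx, hy]

theorem halfSpaceDiff_of_adj {x y : V} (h : T.Adj x y) {p : V × V}
    (hp : T.halfSpaceDiff x y p ≠ 0) : p = (x, y) ∨ p = (y, x) := by
  rw [Ne, halfSpaceDiff_eq_zero_iff] at hp
  by_cases hx : x ∈ T.halfSpace p.1 p.2
  · have hy : y ∉ T.halfSpace p.1 p.2 := fun hy => hp ⟨fun _ => hy, fun _ => hx⟩
    obtain ⟨h1, h2⟩ := eq_of_adj_of_mem_halfSpace h.symm hy hx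
    exact Or.inr (Prod.ext h1.symm h2.symm)
  · have hy : y ∈ T.halfSpace p.1 p.2 := by
      by_contra hy
      exact hp ⟨fun h => absurd h hx, fun h => absurd h hy⟩
    obtain ⟨h1, h2⟩ := eq_of_adj_of_mem_halfSpace h hx hy
    exact Or.inl (Prod.ext h1.symm h2.symm)

theorem halfSpaceDiff_add (x y z : V) (p : V × V) :
    T.halfSpaceDiff x z p = T.halfSpaceDiff x y p + T.halfSpaceDiff y z p := by
  simp [halfSpaceDiff]

theorem Connected.finite_support_halfSpaceDiff (hT : T.Connected) (x y : V) :
    (Function.support (T.halfSpaceDiff x y)).Finite := by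
  have hz := (reachable_iff_reflTransGen _ _).1 (hT x y)
  induction hz with
  | refl =>
    convert Set.finite_empty
    ext p
    simp [halfSpaceDiff]
  | @tail y z _ hyz ih =>
    refine (ih.union (Set.toFinite {(y, z), (z, y)})).subset fun p hp => ?_
    by_contra hcon
    simp only [Set.mem_union, Function.mem_support, not_or, not_not] at hcon
    refine hp ?_
    rw [halfSpaceDiff_add x y z, hcon.1, zero_add]
    by_contra h
    exact hcon.2 (halfSpaceDiff_of_adj hyz h)

theorem Connected.signedCrossing_add (hT : T.Connected) (u v x y z : V) :
    signedCrossing G T u v x z = signedCrossing G T u v x y + signedCrossing G T u v y z := by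
  have hfin : ∀ a b : V, (Function.support fun p : MulAction.orbit G (u, v) =>
      T.halfSpaceDiff a b p).Finite := fun a b =>
    (hT.finite_support_halfSpaceDiff a b).preimage Subtype.val_injective.injOn
  rw [signedCrossing, signedCrossing, signedCrossing, ← finsum_add_distrib (hfin _ _) (hfin _ _)]
  exact finsum_congr fun p => halfSpaceDiff_add _ _ _ _

theorem signedCrossing_smul
    (hadj : ∀ (g : G) (u v : V), T.Adj u v → T.Adj (g • u) (g • v)) (g : G) (u v x y : V) :
    signedCrossing G T u v (g • x) (g • y) = signedCrossing G T u v x y := by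
  classical
  rw [signedCrossing, ← finsum_comp_equiv (MulAction.toPerm g)]
  refine finsum_congr fun p => ?_
  simp only [halfSpaceDiff, MulAction.toPerm_apply, MulAction.orbit.coe_smul, Prod.smul_fst,
    Prod.smul_snd, Set.indicator_apply, smul_mem_halfSpace_iff hadj, Pi.one_apply]

theorem IsTree.signedCrossing_edge (hT : T.IsTree) {u v : V} (huv : T.Adj u v)
    (hinv : ∀ (g : G), ¬(g • u = v ∧ g • v = u)) : signedCrossing G T u v u v = 1 := by
  rw [signedCrossing, finsum_eq_single _ ⟨(u, v), MulAction.mem_orbit_self _⟩]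
  · simp [halfSpaceDiff, mem_halfSpace_self, hT.notMem_halfSpace huv]
  · rintro ⟨p, g, hg⟩ hne
    by_contra h
    rcases halfSpaceDiff_of_adj huv h with h' | h'
    · exact hne (Subtype.ext h')
    · have hgp : (g • u, g • v) = p := hg
      exact hinv g (Prod.mk.inj (hgp.trans h'))

/-- If `G` has no infinite cyclic quotient, then the signed number of crossings between a vertex
and any of its translates vanishes. -/
theorem IsTree.signedCrossing_smul_self (hT : T.IsTree)
    (hadj : ∀ (g : G) (u v : V), T.Adj u v → T.Adj (g • u) (g • v))
    (hZ : ¬ ∃ f : G →* Multiplicative ℤ, Function.Surjective f) (u v x : V) (g : G) :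
    signedCrossing G T u v x (g • x) = 0 := by
  by_contra hne
  refine hZ (exists_surjective_hom_int (fun g => signedCrossing G T u v x (g • x))
    (fun g h => ?_) ⟨g, hne⟩)
  rw [hT.connected.signedCrossing_add u v x (g • x), mul_smul, signedCrossing_smul hadj]

end SimpleGraph

section Alternating

variable {P : Type*} [Group P] {A : Bool → Subgroup P} {C : Subgroup P}

/-- `IsAlternatingProduct A C i j g` says that `g` is a nonempty product of elements taken
alternately from `A true` and `A false`, none of them in `C`, with first factor in `A i` and last in
`A j`. -/
inductive IsAlternatingProduct (A : Bool → Subgroup P) (C : Subgroup P) : Bool → Bool → P → Prop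
  | single {i : Bool} {x : P} (hx : x ∈ A i) (hxC : x ∉ C) : IsAlternatingProduct A C i i x
  | cons {i j : Bool} {x g : P} (hx : x ∈ A i) (hxC : x ∉ C)
      (hg : IsAlternatingProduct A C (!i) j g) : IsAlternatingProduct A C i j (x * g)

namespace IsAlternatingProduct

theorem mul {i j k : Bool} {g h : P} (hg : IsAlternatingProduct A C i j g)
    (hh : IsAlternatingProduct A C (!j) k h) : IsAlternatingProduct A C i k (g * h) := by
  induction hg with
  | single hx hxC => exact cons hx hxC hh
  | cons hx hxC _ ih => rw [mul_assoc]; exact cons hx hxC (ih hh)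

theorem inv {i j : Bool} {g : P} (hg : IsAlternatingProduct A C i j g) :
    IsAlternatingProduct A C j i g⁻¹ := by
  induction hg with
  | single hx hxC => exact single (inv_mem hx) (by simpa using hxC)
  | @cons i j x g hx hxC _ ih =>
    rw [mul_inv_rev]
    exact ih.mul ((Bool.not_not i).symm ▸ single (inv_mem hx) (by simpa using hxC))

theorem mul_left_of_mem (hC : ∀ k, C ≤ A k) {i j : Bool} {c g : P} (hc : c ∈ C)
    (hg : IsAlternatingProduct A C i j g) : IsAlternatingProduct A C i j (c * g) := by
  cases hg with
  | single hx hxC =>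
    exact single (mul_mem (hC _ hc) hx) (by rwa [Subgroup.mul_mem_cancel_left _ hc])
  | cons hx hxC hg =>
    rw [← mul_assoc]
    exact cons (mul_mem (hC _ hc) hx) (by rwa [Subgroup.mul_mem_cancel_left _ hc]) hg

theorem mul_left (hC : ∀ k, C ≤ A k) {i j k : Bool} {x g : P} (hx : x ∈ A k)
    (hg : IsAlternatingProduct A C i j g) :
    (∃ i', IsAlternatingProduct A C i' j (x * g)) ∨ (x * g ∈ C ∧ k = j) := by
  by_cases hki : k = i
  · subst hki
    cases hg with
    | single hy hyC =>
      by_cases hxy : x * g ∈ C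
      · exact Or.inr ⟨hxy, rfl⟩
      · exact Or.inl ⟨_, single (mul_mem hx hy) hxy⟩
    | @cons _ _ y g hy hyC hg =>
      rw [← mul_assoc]
      by_cases hxy : x * y ∈ C
      · exact Or.inl ⟨_, mul_left_of_mem hC hxy hg⟩
      · exact Or.inl ⟨_, cons (mul_mem hx hy) hxy hg⟩
  · by_cases hxC : x ∈ C
    · exact Or.inl ⟨_, mul_left_of_mem hC hxC hg⟩
    · have : i = !k := by cases i <;> cases k <;> simp_all
      subst this
      exact Or.inl ⟨_, cons hx hxC hg⟩

end IsAlternatingProduct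

theorem mem_or_isAlternating (hC : ∀ k, C ≤ A k) (hgen : A true ⊔ A false = ⊤) (g : P) :
    g ∈ C ∨ ∃ i j, IsAlternatingProduct A C i j g := by
  have hstep : ∀ k, ∀ x ∈ A k, ∀ g, (g ∈ C ∨ ∃ i j, IsAlternatingProduct A C i j g) →
      (x * g ∈ C ∨ ∃ i j, IsAlternatingProduct A C i j (x * g)) := by
    rintro k x hx g (hg | ⟨i, j, hg⟩)
    · by_cases hxC : x * g ∈ C
      · exact Or.inl hxC
      · exact Or.inr ⟨k, k, .single (mul_mem hx (hC k hg)) hxC⟩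
    · rcases hg.mul_left hC hx with ⟨i', h⟩ | ⟨h, -⟩
      · exact Or.inr ⟨i', j, h⟩
      · exact Or.inl h
  have hg : g ∈ Subgroup.closure ((A true : Set P) ∪ A false) := by
    rw [← Subgroup.sup_eq_closure, hgen]
    exact Subgroup.mem_top g
  induction hg using Subgroup.closure_induction_left with
  | one => exact Or.inl (one_mem C)
  | mul_left x hx y _ ih =>
    rcases hx with hx | hx
    exacts [hstep _ x hx y ih, hstep _ x hx y ih]
  | inv_mul_cancel x hx y _ ih =>
    rcases hx with hx | hx
    exacts [hstep _ _ (inv_mem hx) y ih, hstep _ _ (inv_mem hx) y ih]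

end Alternating

section Pushout

open Monoid

variable {F : Bool → Type*} {H : Type*} [∀ i, Group (F i)] [Group H]
  {φ : ∀ i, H →* F i}

theorem PushoutI.base_range_le (i : Bool) :
    (PushoutI.base φ).range ≤ (PushoutI.of (φ := φ) i).range := by
  rintro _ ⟨h, rfl⟩
  exact ⟨φ i h, PushoutI.of_apply_eq_base φ i h⟩

theorem PushoutI.range_sup_range :
    (PushoutI.of (φ := φ) true).range ⊔ (PushoutI.of (φ := φ) false).range = ⊤ := by
  rw [eq_top_iff]
  rintro x -
  have hof : ∀ i, (PushoutI.of (φ := φ) i).range ≤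
      (PushoutI.of (φ := φ) true).range ⊔ (PushoutI.of (φ := φ) false).range := by
    rintro (_ | _)
    exacts [le_sup_right, le_sup_left]
  induction x using PushoutI.induction_on with
  | of i g => exact hof i ⟨g, rfl⟩
  | base h => exact hof true (PushoutI.base_range_le true ⟨h, rfl⟩)
  | mul x y hx hy => exact mul_mem hx hy

/-- The normal form theorem for alternating products in an amalgamated free product. -/
theorem PushoutI.notMem_base_range_of_isAlternating (hφ : ∀ i, Function.Injective (φ i))
    {i j : Bool} {g : PushoutI φ}
    (hg : IsAlternatingProduct (fun i => (PushoutI.of (φ := φ) i).range)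
      (PushoutI.base φ).range i j g) :
    g ∉ (PushoutI.base φ).range := by
  have hletter : ∀ (i : Bool) (x : F i), PushoutI.of (φ := φ) i x ∉ (PushoutI.base φ).range →
      x ∉ (φ i).range := by
    rintro i _ hx ⟨h, rfl⟩
    exact hx ⟨h, (PushoutI.of_apply_eq_base φ i h).symm⟩
  have key : ∃ w : CoprodI.Word F, PushoutI.Reduced φ w ∧ w.fstIdx = some i ∧
      PushoutI.ofCoprodI (φ := φ) w.prod = g := by
    induction hg with
    | @single i x hx hxC =>
      obtain ⟨x, rfl⟩ := hx
      have hx := hletter i x hxC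
      have hx1 : x ≠ 1 := by
        rintro rfl
        exact hx (one_mem _)
      refine ⟨CoprodI.Word.cons x CoprodI.Word.empty nofun hx1, ?_,
        CoprodI.Word.fstIdx_cons _ _ _ _, ?_⟩
      · intro l hl
        simp only [CoprodI.Word.cons, CoprodI.Word.empty, List.mem_singleton] at hl
        subst hl
        exact hx
      · rw [CoprodI.Word.prod_cons, CoprodI.Word.prod_empty, mul_one, PushoutI.ofCoprodI_of]
    | @cons i j x g hx hxC _ ih =>
      obtain ⟨x, rfl⟩ := hx
      have hx := hletter i x hxC
      have hx1 : x ≠ 1 := by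
        rintro rfl
        exact hx (one_mem _)
      obtain ⟨w, hw, hfst, rfl⟩ := ih
      refine ⟨CoprodI.Word.cons x w (by rw [hfst]; simp) hx1, ?_,
        CoprodI.Word.fstIdx_cons _ _ _ _, ?_⟩
      · intro l hl
        simp only [CoprodI.Word.cons, List.mem_cons] at hl
        rcases hl with rfl | hl
        exacts [hx, hw l hl]
      · rw [CoprodI.Word.prod_cons, map_mul, PushoutI.ofCoprodI_of]
  obtain ⟨w, hw, hfst, rfl⟩ := key
  intro hmem
  rw [hw.eq_empty_of_mem_range hφ hmem] at hfst
  simp [CoprodI.Word.fstIdx, CoprodI.Word.empty] at hfst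

end Pushout

/-- A connected graph, given by a relation, in which each edge is the only one leaving some set of
vertices is a tree. -/
theorem isTree_fromRel_of_cuts {V : Type*} {r : V → V → Prop}
    (hconn : (SimpleGraph.fromRel r).Connected)
    (hcut : ∀ a b, r a b → ∃ S : Set V, a ∈ S ∧ b ∉ S ∧
      ∀ x y, (r x y ∨ r y x) → x ∈ S → y ∉ S → x = a ∧ y = b) :
    (SimpleGraph.fromRel r).IsTree := by
  have key : ∀ a b, r a b → (SimpleGraph.fromRel r).IsBridge s(a, b) := by
    intro a b hab
    obtain ⟨S, ha, hb, hS⟩ := hcut a b hab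
    rw [SimpleGraph.isBridge_iff]
    suffices ∀ c, ((SimpleGraph.fromRel r).deleteEdges {s(a, b)}).Reachable a c → c ∈ S from
      fun h => hb (this b h)
    intro c hc
    induction (SimpleGraph.reachable_iff_reflTransGen _ _).1 hc with
    | refl => exact ha
    | tail h hxy ih =>
      have ih := ih ((SimpleGraph.reachable_iff_reflTransGen _ _).2 h)
      rw [SimpleGraph.deleteEdges_adj, SimpleGraph.fromRel_adj] at hxy
      by_contra hy
      obtain ⟨rfl, rfl⟩ := hS _ _ hxy.1.2 ih hy
      exact hxy.2 rfl
  refine ⟨hconn, SimpleGraph.isAcyclic_iff_forall_adj_isBridge.2 fun a b hab => ?_⟩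
  rw [SimpleGraph.fromRel_adj] at hab
  rcases hab.2 with h | h
  · exact key a b h
  · rw [Sym2.eq_swap]
    exact key b a h

theorem HasFA.congr {G P : Type*} [Group G] [Group P] (h : HasFA G) (e : G ≃* P) : HasFA P := by
  intro V T hT ρ hadj hinv
  obtain ⟨x, hx⟩ := h V T hT (ρ.comp e.toMonoidHom) (fun g => hadj (e g)) (fun g => hinv (e g))
  exact ⟨x, fun g => by simpa using hx (e.symm g)⟩

section BassSerre

variable {P : Type} [Group P] {A : Bool → Subgroup P} {C : Subgroup P}

/-- The relation joining the cosets `gA` and `gB`, for all `g`. -/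
def cosetRel (A : Bool → Subgroup P) (x y : (P ⧸ A true) ⊕ (P ⧸ A false)) : Prop :=
  ∃ g : P, x = Sum.inl (g : P ⧸ A true) ∧ y = Sum.inr (g : P ⧸ A false)

theorem connected_cosetRel (hgen : A true ⊔ A false = ⊤) :
    (SimpleGraph.fromRel (cosetRel A)).Connected := by
  have hadj : ∀ g : P, (SimpleGraph.fromRel (cosetRel A)).Reachable
      (Sum.inl (g : P ⧸ A true)) (Sum.inr (g : P ⧸ A false)) := fun g =>
    SimpleGraph.Adj.reachable <| by
      rw [SimpleGraph.fromRel_adj]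
      exact ⟨by simp, Or.inl ⟨g, rfl, rfl⟩⟩
  have key : ∀ g : P, (SimpleGraph.fromRel (cosetRel A)).Reachable
      (Sum.inl ((1 : P) : P ⧸ A true)) (Sum.inl (g : P ⧸ A true)) := by
    have hstep : ∀ g x : P, (x ∈ (A true : Set P) ∪ A false) →
        (SimpleGraph.fromRel (cosetRel A)).Reachable (Sum.inl (g : P ⧸ A true))
          (Sum.inl ((g * x : P) : P ⧸ A true)) := by
      rintro g x (hx | hx)
      · rw [QuotientGroup.mk_mul_of_mem g hx]
      · have h := (hadj (g * x)).symm
        rw [QuotientGroup.mk_mul_of_mem g hx] at h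
        exact (hadj g).trans h
    intro g
    have hg : g ∈ Subgroup.closure ((A true : Set P) ∪ A false) := by
      rw [← Subgroup.sup_eq_closure, hgen]
      exact Subgroup.mem_top g
    induction hg using Subgroup.closure_induction_right with
    | one => exact .refl _
    | mul_right x _ y hy ih => exact ih.trans (hstep x y hy)
    | mul_inv_cancel x _ y hy ih =>
      refine ih.trans (hstep x _ ?_)
      simpa using hy
  have : Nonempty ((P ⧸ A true) ⊕ (P ⧸ A false)) := ⟨Sum.inl ((1 : P) : P ⧸ A true)⟩
  refine SimpleGraph.connected_iff_exists_forall_reachable _ |>.2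
    ⟨Sum.inl ((1 : P) : P ⧸ A true), ?_⟩
  rintro (x | x)
  · induction x using QuotientGroup.induction_on with
    | H g => exact key g
  · induction x using QuotientGroup.induction_on with
    | H g => exact (key g).trans (hadj g)

theorem isTree_cosetRel (hC : ∀ k, C ≤ A k) (hgen : A true ⊔ A false = ⊤)
    (hred : ∀ i j g, IsAlternatingProduct A C i j g → g ∉ C) :
    (SimpleGraph.fromRel (cosetRel A)).IsTree := by
  have hcoset : ∀ (k : Bool) {g h : P}, (g : P ⧸ A (!k)) = h →
      (∃ i, IsAlternatingProduct A C i k g⁻¹) → ∃ i, IsAlternatingProduct A C i k h⁻¹ := by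
    rintro k g h hgh ⟨i, hi⟩
    have hmem : (g⁻¹ * h)⁻¹ ∈ A (!k) := inv_mem (QuotientGroup.eq.1 hgh)
    rcases hi.mul_left hC hmem with h' | ⟨-, h'⟩
    · simpa using h'
    · simp at h'
  have hdisj : ∀ {g : P}, (∃ i, IsAlternatingProduct A C i true g⁻¹) →
      ¬ ∃ i, IsAlternatingProduct A C i false g⁻¹ := by
    rintro g ⟨i, hi⟩ ⟨i', hi'⟩
    have h : IsAlternatingProduct A C i i' (g⁻¹ * g⁻¹⁻¹) := hi.mul hi'.inv
    rw [mul_inv_cancel] at h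
    exact hred _ _ _ h (one_mem C)
  have hone : ∀ k, ¬ ∃ i, IsAlternatingProduct A C i k (1 : P)⁻¹ := by
    rintro k ⟨i, hi⟩
    rw [inv_one] at hi
    exact hred _ _ _ hi (one_mem C)
  refine isTree_fromRel_of_cuts (connected_cosetRel hgen) ?_
  rintro _ _ ⟨g₀, rfl, rfl⟩
  let S : Set ((P ⧸ A true) ⊕ (P ⧸ A false)) :=
    {x | (∃ g : P, x = Sum.inl (g : P ⧸ A true) ∧
        ¬ ∃ i, IsAlternatingProduct A C i false (g₀⁻¹ * g)⁻¹) ∨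
      ∃ g : P, x = Sum.inr (g : P ⧸ A false) ∧ ∃ i, IsAlternatingProduct A C i true (g₀⁻¹ * g)⁻¹}
  have htrans : ∀ (k : Bool) {g h : P}, (g : P ⧸ A k) = h →
      ((g₀⁻¹ * g : P) : P ⧸ A k) = (g₀⁻¹ * h : P) := by
    intro k g h hgh
    rw [QuotientGroup.eq] at hgh ⊢
    simpa [mul_assoc] using hgh
  have hinl : ∀ g : P, (Sum.inl (g : P ⧸ A true) ∈ S) ↔
      ¬ ∃ i, IsAlternatingProduct A C i false (g₀⁻¹ * g)⁻¹ := by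
    refine fun g => ⟨?_, fun h => Or.inl ⟨g, rfl, h⟩⟩
    rintro (⟨h, hgh, hh⟩ | ⟨h, hgh, -⟩)
    · exact fun h' => hh (hcoset false (htrans true (Sum.inl.inj hgh)) h')
    · simp at hgh
  have hinr : ∀ g : P, (Sum.inr (g : P ⧸ A false) ∈ S) ↔
      ∃ i, IsAlternatingProduct A C i true (g₀⁻¹ * g)⁻¹ := by
    refine fun g => ⟨?_, fun h => Or.inr ⟨g, rfl, h⟩⟩
    rintro (⟨h, hgh, -⟩ | ⟨h, hgh, hh⟩)
    · simp at hgh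
    · exact hcoset true (htrans false (Sum.inr.inj hgh)).symm hh
  refine ⟨S, ?_, ?_, ?_⟩
  · rw [hinl, inv_mul_cancel]
    exact hone _
  · rw [hinr, inv_mul_cancel]
    exact hone _
  · rintro x y (⟨g, rfl, rfl⟩ | ⟨g, rfl, rfl⟩) hx hy
    · rw [hinl] at hx
      rw [hinr] at hy
      have hgC : (g₀⁻¹ * g)⁻¹ ∈ C := by
        rcases mem_or_isAlternating hC hgen (g₀⁻¹ * g)⁻¹ with h | ⟨i, j, h⟩
        · exact h
        · cases j
          exacts [absurd ⟨i, h⟩ hx, absurd ⟨i, h⟩ hy]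
      have heq : ∀ k, (g : P ⧸ A k) = g₀ := fun k => by
        rw [eq_comm, QuotientGroup.eq]
        exact hC k (by simpa using inv_mem hgC)
      rw [heq, heq]
      exact ⟨rfl, rfl⟩
    · rw [hinr] at hx
      rw [hinl, not_not] at hy
      exact absurd hy (hdisj hx)

theorem HasFA.exists_eq_top (h : HasFA P) (hC : ∀ k, C ≤ A k) (hgen : A true ⊔ A false = ⊤)
    (hred : ∀ i j g, IsAlternatingProduct A C i j g → g ∉ C) : ∃ k, A k = ⊤ := by
  have hrel : ∀ (g : P) x y, cosetRel A x y → cosetRel A (g • x) (g • y) := by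
    rintro g _ _ ⟨k, rfl, rfl⟩
    exact ⟨g * k, rfl, rfl⟩
  have hadj : ∀ (g : P) x y, (SimpleGraph.fromRel (cosetRel A)).Adj x y →
      (SimpleGraph.fromRel (cosetRel A)).Adj (g • x) (g • y) := by
    intro g x y hxy
    rw [SimpleGraph.fromRel_adj] at hxy ⊢
    exact ⟨fun h => hxy.1 (MulAction.injective g h), hxy.2.imp (hrel g x y) (hrel g y x)⟩
  have hinv : ∀ (g : P) x y, (SimpleGraph.fromRel (cosetRel A)).Adj x y →
      ¬(g • x = y ∧ g • y = x) := by
    rintro g x y hxy ⟨h1, h2⟩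
    rw [SimpleGraph.fromRel_adj] at hxy
    rcases hxy.2 with ⟨k, rfl, rfl⟩ | ⟨k, rfl, rfl⟩
    · exact Sum.inl_ne_inr h1
    · exact Sum.inl_ne_inr h2
  have htop : ∀ (k : Bool) (x : P ⧸ A k), (∀ g : P, g • x = x) → A k = ⊤ := by
    intro k x hx
    induction x using QuotientGroup.induction_on with
    | H y =>
      rw [eq_top_iff]
      rintro g -
      have := hx (y * g⁻¹ * y⁻¹)
      rw [MulAction.Quotient.smul_coe, QuotientGroup.eq] at this
      simpa [mul_assoc] using this
  obtain ⟨x, hx⟩ := h _ _ (isTree_cosetRel hC hgen hred) (MulAction.toPermHom P _) hadj hinv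
  rcases x with x | x
  · exact ⟨true, htop true x fun g => Sum.inl.inj (hx g)⟩
  · exact ⟨false, htop false x fun g => Sum.inr.inj (hx g)⟩

end BassSerre

/-- Property (FA), applied to the tree joining each vertex to its image under a shift `p`. -/
theorem HasFA.exists_fixed_of_parent {G : Type*} [Group G] (h : HasFA G) {V : Type} [Nonempty V]
    (p : V → V) (ℓ : V → ℤ) (hℓ : ∀ x, ℓ (p x) = ℓ x + 1)
    (hmeet : ∀ x y, ∃ i j, p^[i] x = p^[j] y) (ρ : G →* Equiv.Perm V)
    (hρ : ∀ g x, ρ g (p x) = p (ρ g x)) : ∃ x, ∀ g, ρ g x = x := by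
  have hiter : ∀ (n : ℕ) x, ℓ (p^[n] x) = ℓ x + n := by
    intro n x
    induction n generalizing x with
    | zero => simp
    | succ n ih => rw [Function.iterate_succ_apply, ih, hℓ]; push_cast; ring
  have hne : ∀ x, x ≠ p x := fun x hx => by
    have := hℓ x
    rw [← hx] at this
    omega
  set T := SimpleGraph.fromRel fun x y => y = p x with hTdef
  have hTp : ∀ x, T.Adj x (p x) := fun x => by
    rw [hTdef, SimpleGraph.fromRel_adj]
    exact ⟨hne x, Or.inl rfl⟩
  have hTiter : ∀ (n : ℕ) x, T.Reachable x (p^[n] x) := by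
    intro n x
    induction n with
    | zero => exact .refl _
    | succ n ih =>
      rw [Function.iterate_succ_apply']
      exact ih.trans (hTp _).reachable
  have hT : T.IsTree := by
    refine isTree_fromRel_of_cuts ⟨fun x y => ?_⟩ ?_
    · obtain ⟨i, j, hij⟩ := hmeet x y
      exact (hTiter i x).trans (hij ▸ (hTiter j y).symm)
    · rintro a _ rfl
      refine ⟨{y | ∃ n, p^[n] y = a}, ⟨0, rfl⟩, ?_, ?_⟩
      · rintro ⟨n, hn⟩
        have := hiter n (p a)
        rw [hn, hℓ] at this
        omega
      · rintro x y (rfl | rfl) ⟨n, hn⟩ hy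
        · cases n with
          | zero =>
            have hxa : x = a := hn
            exact ⟨hxa, by rw [hxa]⟩
          | succ n => exact absurd ⟨n, hn⟩ hy
        · exact absurd ⟨n + 1, hn⟩ hy
  refine h V T hT ρ (fun g u v huv => ?_) ?_
  · rw [hTdef, SimpleGraph.fromRel_adj] at huv ⊢
    refine ⟨fun h => huv.1 ((ρ g).injective h), ?_⟩
    rcases huv.2 with rfl | rfl
    exacts [Or.inl (hρ g _), Or.inr (hρ g _)]
  · have key : ∀ g x, ρ g x = p x → ρ g (p x) ≠ x := by
      intro g x h1 h2
      rw [hρ, h1] at h2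
      have h3 := hiter 2 x
      have h4 : p^[2] x = x := h2
      rw [h4] at h3
      push_cast at h3
      omega
    rintro g u v huv ⟨h1, h2⟩
    rw [hTdef, SimpleGraph.fromRel_adj] at huv
    rcases huv.2 with rfl | rfl
    exacts [key g _ h1 h2, key g _ h2 h1]

theorem HasFA.not_exists_surjective_int {G : Type*} [Group G] (h : HasFA G) :
    ¬ ∃ f : G →* Multiplicative ℤ, Function.Surjective f := by
  rintro ⟨f, hf⟩
  let ρ : G →* Equiv.Perm ℤ := MonoidHom.mk' (fun g => Equiv.addLeft (f g).toAdd) fun a b => by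
    ext x
    simp
  have hshift : ∀ (n : ℕ) (x : ℤ), (fun x : ℤ => x + 1)^[n] x = x + n := by
    intro n x
    simp
  obtain ⟨x, hx⟩ := h.exists_fixed_of_parent (fun x : ℤ => x + 1) id (fun _ => rfl)
    (fun x y => ⟨(y - x).toNat, (x - y).toNat, by rw [hshift, hshift]; omega⟩) ρ
    (fun g x => (add_assoc _ _ _).symm)
  obtain ⟨g, hg⟩ := hf (Multiplicative.ofAdd 1)
  have := hx g
  change (f g).toAdd + x = x at this
  rw [hg, toAdd_ofAdd] at this
  omega

/-- A group with Property (FA) is not the union of a chain of proper subgroups. -/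
theorem HasFA.exists_eq_top_of_monotone {G : Type} [Group G] (h : HasFA G) (K : ℕ → Subgroup G)
    (hK : Monotone K) (hcover : ∀ g, ∃ n, g ∈ K n) : ∃ n, K n = ⊤ := by
  let p : (Σ n, G ⧸ K n) → Σ n, G ⧸ K n := fun x =>
    ⟨x.1 + 1, Subgroup.quotientMapOfLE (hK (Nat.le_succ x.1)) x.2⟩
  have hp : ∀ (i n : ℕ) (g : G), p^[i] ⟨n, (g : G ⧸ K n)⟩ = ⟨n + i, (g : G ⧸ K (n + i))⟩ := by
    intro i n g
    induction i with
    | zero => rfl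
    | succ i ih =>
      rw [Function.iterate_succ_apply', ih]
      rfl
  have hmk : ∀ {m n : ℕ} (g : G), m = n →
      (⟨m, (g : G ⧸ K m)⟩ : Σ n, G ⧸ K n) = ⟨n, (g : G ⧸ K n)⟩ := by
    rintro m _ g rfl
    rfl
  have hmeet : ∀ x y, ∃ i j, p^[i] x = p^[j] y := by
    rintro ⟨m, x⟩ ⟨n, y⟩
    induction x using QuotientGroup.induction_on with
    | H a =>
    induction y using QuotientGroup.induction_on with
    | H b =>
    obtain ⟨k, hk⟩ := hcover (a⁻¹ * b)
    let N := max k (max m n)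
    refine ⟨N - m, N - n, ?_⟩
    rw [hp, hp, hmk a (show m + (N - m) = N by omega), hmk b (show n + (N - n) = N by omega)]
    congr 1
    rw [QuotientGroup.eq]
    exact hK (le_max_left _ _) hk
  have : Nonempty (Σ n, G ⧸ K n) := ⟨⟨0, ((1 : G) : G ⧸ K 0)⟩⟩
  obtain ⟨⟨n, x⟩, hx⟩ := h.exists_fixed_of_parent p (fun x => x.1)
    (fun x => by simp [p]) hmeet (MulAction.toPermHom G _) (by
      rintro g ⟨n, x⟩
      induction x using QuotientGroup.induction_on with
      | H a => rfl)
  refine ⟨n, ?_⟩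
  induction x using QuotientGroup.induction_on with
  | H y =>
    rw [eq_top_iff]
    rintro g -
    have h1 := hx (y * g⁻¹ * y⁻¹)
    have h2 : ((y * g⁻¹ * y⁻¹ * y : G) : G ⧸ K n) = y := eq_of_heq (Sigma.mk.inj h1).2
    rw [QuotientGroup.eq] at h2
    simpa [mul_assoc] using h2

theorem HasFA.fg {G : Type} [Group G] [Countable G] (h : HasFA G) : Group.FG G := by
  obtain ⟨f, hf⟩ := exists_surjective_nat G
  obtain ⟨n, hn⟩ := h.exists_eq_top_of_monotone (fun n => Subgroup.closure (f '' Set.Iio n))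
    (fun m n hmn => Subgroup.closure_mono (Set.image_mono (Set.Iio_subset_Iio hmn)))
    (fun g => by
      obtain ⟨n, rfl⟩ := hf g
      exact ⟨n + 1, Subgroup.subset_closure ⟨n, Nat.lt_succ_self n, rfl⟩⟩)
  exact Group.fg_iff.2 ⟨_, hn, (Set.finite_Iio n).image f⟩

theorem phiFam_injective {A B C : Type u} [Group A] [Group B] [Group C] {i : C →* A} {j : C →* B}
    (hi : Function.Injective i) (hj : Function.Injective j) :
    ∀ b, Function.Injective (phiFam i j b)
  | true => hi
  | false => hj

theorem HasFA.not_nonempty_amalgamWitness {G : Type} [Group G] (h : HasFA G) :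
    ¬ Nonempty (AmalgamWitness G) := by
  rintro ⟨W⟩
  let := W.gA
  let := W.gB
  let := W.gC
  have hφ := phiFam_injective W.inj_i W.inj_j
  obtain ⟨k, hk⟩ := (h.congr W.iso).exists_eq_top (PushoutI.base_range_le (φ := phiFam W.i W.j))
    PushoutI.range_sup_range fun i j g => PushoutI.notMem_base_range_of_isAlternating hφ
  have hsurj : Function.Surjective (phiFam W.i W.j (!k)) := by
    intro x
    have hx : Monoid.PushoutI.of (φ := phiFam W.i W.j) (!k) x ∈
        (Monoid.PushoutI.base (phiFam W.i W.j)).range := by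
      rw [← Monoid.PushoutI.inf_of_range_eq_base_range hφ (Bool.not_ne_self k)]
      exact ⟨⟨x, rfl⟩, hk ▸ Subgroup.mem_top _⟩
    obtain ⟨c, hc⟩ := hx
    refine ⟨c, Monoid.PushoutI.of_injective hφ (!k) ?_⟩
    rw [Monoid.PushoutI.of_apply_eq_base, hc]
  cases k
  exacts [W.not_surj_i hsurj, W.not_surj_j hsurj]

namespace SimpleGraph

section Splitting

variable {V : Type*} {T : SimpleGraph V} {G : Type*} [Group G] [MulAction G V]

/-- No half-space of an edge in the orbit of `(u, v)` separates `x` from `y`. -/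
def Unseparated (G : Type*) [Group G] [MulAction G V] (T : SimpleGraph V) (u v x y : V) : Prop :=
  ∀ g : G, x ∈ T.halfSpace (g • u) (g • v) ↔ y ∈ T.halfSpace (g • u) (g • v)

namespace Unseparated

variable {u v x y z : V}

protected theorem refl (u v x : V) : Unseparated G T u v x x := fun _ => Iff.rfl

protected theorem symm (h : Unseparated G T u v x y) : Unseparated G T u v y x :=
  fun g => (h g).symm

protected theorem trans (h : Unseparated G T u v x y) (h' : Unseparated G T u v y z) :
    Unseparated G T u v x z :=
  fun g => (h g).trans (h' g)

theorem mem_iff (h : Unseparated G T u v x y) : x ∈ T.halfSpace u v ↔ y ∈ T.halfSpace u v := by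
  simpa using h 1

theorem swap (hT : T.IsTree) (hadj : ∀ (g : G) (u v : V), T.Adj u v → T.Adj (g • u) (g • v))
    (huv : T.Adj u v) (h : Unseparated G T u v x y) : Unseparated G T v u x y := fun g => by
  rw [hT.mem_halfSpace_swap (hadj g _ _ huv), hT.mem_halfSpace_swap (hadj g _ _ huv), h g]

theorem smul (hadj : ∀ (g : G) (u v : V), T.Adj u v → T.Adj (g • u) (g • v)) (k : G)
    (h : Unseparated G T u v x y) : Unseparated G T u v (k • x) (k • y) := fun g => by
  have := h (k⁻¹ * g)
  rw [mul_smul, mul_smul] at this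
  rwa [← smul_mem_halfSpace_iff hadj k (z := x), ← smul_mem_halfSpace_iff hadj k (z := y),
    smul_inv_smul, smul_inv_smul] at this

theorem signedCrossing_eq_zero (h : Unseparated G T u v x y) : signedCrossing G T u v x y = 0 := by
  rw [signedCrossing]
  refine finsum_eq_zero_of_forall_eq_zero ?_
  rintro ⟨_, g, rfl⟩
  exact halfSpaceDiff_eq_zero_iff.2 (h g)

end Unseparated

/-- The stabilizer of the component of `x` in the complement of the orbit of the edge `(u, v)`. -/
def componentStabilizer (hadj : ∀ (g : G) (u v : V), T.Adj u v → T.Adj (g • u) (g • v))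
    (u v x : V) : Subgroup G where
  carrier := {g | Unseparated G T u v x (g • x)}
  one_mem' := by
    change Unseparated G T u v x ((1 : G) • x)
    rw [one_smul]
    exact .refl _ _ _
  mul_mem' {g h} hg hh := by
    change Unseparated G T u v x ((g * h) • x)
    rw [mul_smul]
    exact hg.trans (hh.smul hadj g)
  inv_mem' {g} hg := by
    have := (hg.smul hadj g⁻¹).symm
    rwa [inv_smul_smul] at this

theorem mem_componentStabilizer
    {hadj : ∀ (g : G) (u v : V), T.Adj u v → T.Adj (g • u) (g • v)} {u v x : V} {g : G} :
    g ∈ componentStabilizer hadj u v x ↔ Unseparated G T u v x (g • x) :=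
  Iff.rfl

/-- An element stabilizing the component of `u` but not that of `v` moves the half-space of
`(u, v)` into its complement, away from the component of `u`. -/
theorem IsTree.smul_notMem_halfSpace (hT : T.IsTree)
    (hadj : ∀ (g : G) (u v : V), T.Adj u v → T.Adj (g • u) (g • v)) {u v : V} (huv : T.Adj u v)
    {g : G} (hu : Unseparated G T u v u (g • u)) (hv : ¬ Unseparated G T u v v (g • v)) {x : V}
    (hx : x ∈ T.halfSpace u v) :
    g • x ∉ T.halfSpace u v ∧ ¬ Unseparated G T u v (g • x) u := by
  have hguv := hadj g _ _ huv
  have hne : ¬ g • v = v := fun h => hv (h.symm ▸ .refl _ _ _)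
  have hu' : u ∉ T.halfSpace (g • u) (g • v) := fun h => hT.notMem_halfSpace hguv ((hu g).1 h)
  have hgu : g • u ∉ T.halfSpace u v := fun h => hT.notMem_halfSpace huv (hu.mem_iff.2 h)
  have hv' : v ∉ T.halfSpace (g • u) (g • v) := fun h =>
    hne (eq_of_adj_of_mem_halfSpace huv hu' h).2.symm
  have hgv : g • v ∉ T.halfSpace u v := fun h =>
    hne (eq_of_adj_of_mem_halfSpace hguv hgu h).2
  have hgx := smul_mem_halfSpace_of_mem hadj g hx
  refine ⟨?_, fun h => hu' ((h g).1 hgx)⟩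
  rw [← hT.mem_halfSpace_swap huv]
  exact halfSpace_subset hv' ((hT.mem_halfSpace_swap huv _).2 hgv) hgx

/-- Every vertex lies in the component of a translate of `u` or `v` by the subgroup generated by
the stabilizers of their components, provided that `u` and `v` are on different levels. -/
theorem IsTree.exists_unseparated (hT : T.IsTree)
    (hadj : ∀ (g : G) (u v : V), T.Adj u v → T.Adj (g • u) (g • v)) {u v : V}
    (hlevel : ∀ g : G, ¬ Unseparated G T u v u (g • v)) (x : V) :
    ∃ k ∈ componentStabilizer hadj u v u ⊔ componentStabilizer hadj u v v,
      Unseparated G T u v x (k • u) ∨ Unseparated G T u v x (k • v) := by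
  have hcancel : ∀ {a b : V} {g k : G}, Unseparated G T u v (g • a) (k • b) →
      Unseparated G T u v a ((g⁻¹ * k) • b) := by
    intro a b g k h
    have := h.smul hadj g⁻¹
    rwa [inv_smul_smul, smul_smul] at this
  have huu : ∀ {g k : G}, k ∈ componentStabilizer hadj u v u ⊔ componentStabilizer hadj u v v →
      Unseparated G T u v (g • u) (k • u) ∨ Unseparated G T u v (g • u) (k • v) →
      g ∈ componentStabilizer hadj u v u ⊔ componentStabilizer hadj u v v := by
    rintro g k hk (h | h)
    · have h1 := Subgroup.mem_sup_left (T := componentStabilizer hadj u v v)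
        ((mem_componentStabilizer (hadj := hadj)).2 (hcancel h))
      have h2 := mul_mem hk (inv_mem h1)
      simpa using h2
    · exact absurd (hcancel h) (hlevel _)
  have hvv : ∀ {g k : G}, k ∈ componentStabilizer hadj u v u ⊔ componentStabilizer hadj u v v →
      Unseparated G T u v (g • v) (k • u) ∨ Unseparated G T u v (g • v) (k • v) →
      g ∈ componentStabilizer hadj u v u ⊔ componentStabilizer hadj u v v := by
    rintro g k hk (h | h)
    · exact absurd (hcancel h.symm) (hlevel _)
    · have h1 := Subgroup.mem_sup_right (S := componentStabilizer hadj u v u)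
        ((mem_componentStabilizer (hadj := hadj)).2 (hcancel h))
      have h2 := mul_mem hk (inv_mem h1)
      simpa using h2
  induction (reachable_iff_reflTransGen _ _).1 (hT.connected u x) with
  | refl => exact ⟨1, one_mem _, Or.inl (by rw [one_smul]; exact .refl _ _ _)⟩
  | @tail x y _ hxy ih =>
    obtain ⟨k, hk, h⟩ := ih
    by_cases hsep : Unseparated G T u v x y
    · exact ⟨k, hk, h.imp hsep.symm.trans hsep.symm.trans⟩
    obtain ⟨g, hg⟩ := not_forall.1 hsep
    by_cases hx : x ∈ T.halfSpace (g • u) (g • v)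
    · have hy : y ∉ T.halfSpace (g • u) (g • v) := fun hy => hg ⟨fun _ => hy, fun _ => hx⟩
      obtain ⟨rfl, rfl⟩ := eq_of_adj_of_mem_halfSpace hxy.symm hy hx
      exact ⟨g, hvv hk h, Or.inl (.refl _ _ _)⟩
    · have hy : y ∈ T.halfSpace (g • u) (g • v) := by
        by_contra hy
        exact hg ⟨fun h => absurd h hx, fun h => absurd h hy⟩
      obtain ⟨rfl, rfl⟩ := eq_of_adj_of_mem_halfSpace hxy hx hy
      exact ⟨g, huu hk h, Or.inr (.refl _ _ _)⟩

theorem IsTree.componentStabilizer_sup (hT : T.IsTree)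
    (hadj : ∀ (g : G) (u v : V), T.Adj u v → T.Adj (g • u) (g • v)) {u v : V}
    (hlevel : ∀ g : G, ¬ Unseparated G T u v u (g • v)) :
    componentStabilizer hadj u v u ⊔ componentStabilizer hadj u v v = ⊤ := by
  rw [eq_top_iff]
  rintro g -
  obtain ⟨k, hk, h⟩ := hT.exists_unseparated hadj hlevel (g • u)
  rcases h with h | h <;> have h := h.smul hadj g⁻¹ <;> rw [inv_smul_smul, smul_smul] at h
  · have h1 := Subgroup.mem_sup_left (T := componentStabilizer hadj u v v)
      ((mem_componentStabilizer (hadj := hadj)).2 h)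
    have h2 := mul_mem hk (inv_mem h1)
    simpa using h2
  · exact absurd h (hlevel _)

/-- Alternating products of elements of the two component stabilizers are non-trivial. -/
theorem IsTree.ne_one_of_isAlternating (hT : T.IsTree)
    (hadj : ∀ (g : G) (u v : V), T.Adj u v → T.Adj (g • u) (g • v)) {u v : V} (huv : T.Adj u v)
    {i j : Bool} {g : G}
    (hg : IsAlternatingProduct
      (fun b => bif b then componentStabilizer hadj u v u else componentStabilizer hadj u v v)
      (componentStabilizer hadj u v u ⊓ componentStabilizer hadj u v v) i j g) : g ≠ 1 := by
  let X : Bool → Set V := fun b => bif b then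
    {x | x ∉ T.halfSpace u v ∧ ¬ Unseparated G T u v x u} else
    {x | x ∈ T.halfSpace u v ∧ ¬ Unseparated G T u v x v}
  have hstepA : ∀ a ∈ componentStabilizer hadj u v u,
      a ∉ componentStabilizer hadj u v u ⊓ componentStabilizer hadj u v v →
      ∀ x ∈ T.halfSpace u v, a • x ∈ X true := fun a ha haC x hx =>
    hT.smul_notMem_halfSpace hadj huv ha (fun h => haC ⟨ha, h⟩) hx
  have hstepB : ∀ b ∈ componentStabilizer hadj u v v,
      b ∉ componentStabilizer hadj u v u ⊓ componentStabilizer hadj u v v →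
      ∀ x, x ∉ T.halfSpace u v → b • x ∈ X false := by
    intro b hb hbC x hx
    have h := hT.smul_notMem_halfSpace hadj huv.symm (hb.swap hT hadj huv)
      (fun h => hbC ⟨h.swap hT hadj huv.symm, hb⟩) ((hT.mem_halfSpace_swap huv x).2 hx)
    rw [hT.mem_halfSpace_swap huv, not_not] at h
    exact ⟨h.1, fun h' => h.2 (h'.swap hT hadj huv)⟩
  have key : g • (bif j then v else u) ∈ X i := by
    induction hg with
    | @single i x hx hxC =>
      cases i
      · exact hstepB x hx hxC u (hT.notMem_halfSpace huv)
      · exact hstepA x hx hxC v (mem_halfSpace_self _ _)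
    | @cons i j x g hx hxC _ ih =>
      rw [mul_smul]
      cases i
      · exact hstepB x hx hxC _ ih.1
      · exact hstepA x hx hxC _ ih.1
  rintro rfl
  rw [one_smul] at key
  cases i <;> cases j
  · exact hT.notMem_halfSpace huv key.1
  · exact key.2 (.refl _ _ _)
  · exact key.2 (.refl _ _ _)
  · exact key.1 (mem_halfSpace_self _ _)

end Splitting

end SimpleGraph

section AmalgamOfSubgroups

variable {G : Type} [Group G]

/-- A group generated by two subgroups `A` and `B`, none contained in the other, and whose
alternating products are non-trivial is their amalgamated free product. -/
theorem nonempty_amalgamWitness_of_subgroups (A B : Subgroup G) (hAB : ¬ A ≤ B) (hBA : ¬ B ≤ A)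
    (hgen : A ⊔ B = ⊤)
    (hred : ∀ i j g, IsAlternatingProduct (fun b => bif b then A else B) (A ⊓ B) i j g → g ≠ 1) :
    Nonempty (AmalgamWitness G) := by
  let i : (A ⊓ B : Subgroup G) →* A := Subgroup.inclusion inf_le_left
  let j : (A ⊓ B : Subgroup G) →* B := Subgroup.inclusion inf_le_right
  let F : ∀ b, FactorFam A B b →* G
    | true => A.subtype
    | false => B.subtype
  let Φ : Monoid.PushoutI (phiFam i j) →* G := Monoid.PushoutI.lift F (A ⊓ B).subtype <| by
    rintro (_ | _) <;> rfl
  have hof : ∀ b x, Φ (Monoid.PushoutI.of b x) = F b x := fun b x =>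
    Monoid.PushoutI.lift_of _ _ _ x
  have hbase : ∀ c, Φ (Monoid.PushoutI.base (phiFam i j) c) = c := fun c =>
    Monoid.PushoutI.lift_base _ _ _ c
  have hi : Function.Injective i := Subgroup.inclusion_injective _
  have hj : Function.Injective j := Subgroup.inclusion_injective _
  have hsurj : Function.Surjective Φ := by
    rw [← MonoidHom.range_eq_top, eq_top_iff, ← hgen, sup_le_iff]
    exact ⟨fun a ha => ⟨Monoid.PushoutI.of (φ := phiFam i j) true (⟨a, ha⟩ : A), hof _ _⟩,
      fun b hb => ⟨Monoid.PushoutI.of (φ := phiFam i j) false (⟨b, hb⟩ : B), hof _ _⟩⟩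
  have hletter : ∀ (b : Bool) (x : Monoid.PushoutI (phiFam i j)),
      x ∈ (Monoid.PushoutI.of (φ := phiFam i j) b).range →
      x ∉ (Monoid.PushoutI.base (phiFam i j)).range →
      Φ x ∈ (bif b then A else B) ∧ Φ x ∉ A ⊓ B := by
    rintro b _ ⟨x, rfl⟩ hx
    rw [hof]
    cases b
    · exact ⟨Subtype.property (p := (· ∈ B)) x, fun hxC => hx ⟨⟨_, hxC⟩,
        (Monoid.PushoutI.of_apply_eq_base (phiFam i j) false ⟨_, hxC⟩).symm⟩⟩
    · exact ⟨Subtype.property (p := (· ∈ A)) x, fun hxC => hx ⟨⟨_, hxC⟩,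
        (Monoid.PushoutI.of_apply_eq_base (phiFam i j) true ⟨_, hxC⟩).symm⟩⟩
  have halt : ∀ k l x, IsAlternatingProduct
      (fun b => (Monoid.PushoutI.of (φ := phiFam i j) b).range)
      (Monoid.PushoutI.base (phiFam i j)).range k l x →
      IsAlternatingProduct (fun b => bif b then A else B) (A ⊓ B) k l (Φ x) := by
    intro k l x hx
    induction hx with
    | single hx hxC =>
      obtain ⟨h1, h2⟩ := hletter _ _ hx hxC
      exact .single h1 h2
    | cons hx hxC _ ih =>
      obtain ⟨h1, h2⟩ := hletter _ _ hx hxC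
      rw [map_mul]
      exact .cons h1 h2 ih
  have hinj : Function.Injective Φ := by
    rw [injective_iff_map_eq_one]
    intro x hx
    rcases mem_or_isAlternating PushoutI.base_range_le PushoutI.range_sup_range x with
      ⟨c, rfl⟩ | ⟨k, l, h⟩
    · rw [hbase] at hx
      rw [Subtype.ext (a1 := c) (a2 := 1) hx, map_one]
    · exact absurd hx (hred _ _ _ (halt k l x h))
  refine ⟨{ A := A, B := B, C := (A ⊓ B : Subgroup G), i := i, j := j, inj_i := hi, inj_j := hj,
            not_surj_i := fun hs => hAB fun a ha => ?_,
            not_surj_j := fun hs => hBA fun b hb => ?_,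
            iso := (MulEquiv.ofBijective Φ ⟨hinj, hsurj⟩).symm }⟩
  · obtain ⟨c, hc⟩ := hs ⟨a, ha⟩
    have : (c : G) = a := congrArg Subtype.val hc
    exact this ▸ c.2.2
  · obtain ⟨c, hc⟩ := hs ⟨b, hb⟩
    have : (c : G) = b := congrArg Subtype.val hc
    exact this ▸ c.2.1

end AmalgamOfSubgroups

/-- A group without infinite cyclic quotient acting on a tree, some element of which translates a
half-space strictly into itself, is a non-trivial amalgamated free product. -/
theorem SimpleGraph.IsTree.nonempty_amalgamWitness {G : Type} [Group G] {V : Type*} [MulAction G V]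
    {T : SimpleGraph V} (hT : T.IsTree)
    (hadj : ∀ (g : G) (u v : V), T.Adj u v → T.Adj (g • u) (g • v))
    (hinv : ∀ (g : G) (u v : V), T.Adj u v → ¬(g • u = v ∧ g • v = u))
    (hZ : ¬ ∃ f : G →* Multiplicative ℤ, Function.Surjective f) {u v : V} (huv : T.Adj u v) {g : G}
    (hg : T.halfSpace (g • u) (g • v) ⊂ T.halfSpace u v) : Nonempty (AmalgamWitness G) := by
  have hlevel : ∀ k : G, ¬ Unseparated G T u v u (k • v) := by
    intro k hk
    have h1 := hT.connected.signedCrossing_add (G := G) u v u v (k • v)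
    rw [hk.signedCrossing_eq_zero, hT.signedCrossing_edge huv fun g => hinv g u v huv,
      hT.signedCrossing_smul_self hadj hZ] at h1
    omega
  have hne : ¬(g • u = u ∧ g • v = v) := fun h => hg.ne (by rw [h.1, h.2])
  have hu : u ∉ T.halfSpace u v := hT.notMem_halfSpace huv
  have hgen := hT.componentStabilizer_sup hadj hlevel
  have hu' : g ∉ componentStabilizer hadj u v u := by
    intro h
    have hgu : g • u ∉ T.halfSpace u v := fun h' => hu (h.mem_iff.2 h')
    exact hne (eq_of_adj_of_mem_halfSpace (hadj g _ _ huv) hgu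
      (hg.subset (mem_halfSpace_self _ _)))
  have hv' : g ∉ componentStabilizer hadj u v v := by
    intro h
    have hv : v ∈ T.halfSpace (g • u) (g • v) := (h g).2 (mem_halfSpace_self _ _)
    obtain ⟨h1, h2⟩ := eq_of_adj_of_mem_halfSpace huv (fun h => hu (hg.subset h)) hv
    exact hne ⟨h1.symm, h2.symm⟩
  refine nonempty_amalgamWitness_of_subgroups (componentStabilizer hadj u v u)
    (componentStabilizer hadj u v v) (fun hle => hv' ?_) (fun hle => hu' ?_) hgen
    fun i j k => hT.ne_one_of_isAlternating hadj huv
  · rw [sup_eq_right.2 hle] at hgen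
    exact hgen ▸ Subgroup.mem_top g
  · rw [sup_eq_left.2 hle] at hgen
    exact hgen ▸ Subgroup.mem_top g

theorem hasFA_of_fg {G : Type} [Group G] [Group.FG G] (hA : ¬ Nonempty (AmalgamWitness G))
    (hZ : ¬ ∃ f : G →* Multiplicative ℤ, Function.Surjective f) : HasFA G := by
  intro V T hT ρ hadj hinv
  let : MulAction G V := MulAction.compHom V ρ
  exact hT.exists_fixed_of_fg hadj hinv fun g u v huv hg =>
    hA (hT.nonempty_amalgamWitness hadj hinv hZ huv hg)

/-- Serre's characterisation for countable groups: `G` has Property (FA) iff `G` is not a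
non-trivial amalgamated free product, has no quotient isomorphic to `ℤ`, and is finitely
generated. In particular a countable group with Property (FA) is finitely generated. -/
theorem stmt_19 (G : Type) [Group G] [Countable G] :
    (HasFA G ↔
      ¬ Nonempty (AmalgamWitness G) ∧
      (¬ ∃ f : G →* Multiplicative ℤ, Function.Surjective f) ∧
      Group.FG G) ∧
    (HasFA G → Group.FG G) := by
  refine ⟨⟨fun h => ⟨h.not_nonempty_amalgamWitness, h.not_exists_surjective_int, h.fg⟩, ?_⟩,
    HasFA.fg⟩
  rintro ⟨hA, hZ, hfg⟩
  exact hasFA_of_fg hA hZ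
end
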